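/- Let W be a measurable space and (f_w)_{w∈W} a family of functions ℝ^k → ℝ such that (w,x) ↦ f_w(x) is jointly measurable, each f_w is L-Lipschitz, and |f_w(x)| ≤ M for all w ∈ W and all x with ‖x‖₂ ≤ R. Let α be a probability measure on W and define f_α(x) := ∫ f_w(x) dα(w). Then for every ε with 0 < ε ≤ 4LR and every positive integer m ≥ (8M²/ε²)·( k·log(12LR/ε) + log 2 ), there exist w_1, …, w_m ∈ W such that sup_{‖x‖₂ ≤ R} | (1/m)·∑_{i=1}^m f_{w_i}(x) − f_α(x) | ≤ ε. -/

import Mathlib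

open MeasureTheory
open scoped ENNReal NNReal

section Net

open Metric Module

variable {E : Type*} [NormedAddCommGroup E] [NormedSpace ℝ E] [FiniteDimensional ℝ E]

/-- Volume bound for the cardinality of a `δ`-separated subset of a ball of radius `R`. -/
lemma card_mul_pow_le_of_separated (s : Finset E) {R δ : ℝ} (hR : 0 ≤ R) (hδ : 0 < δ)
    (hs : ∀ c ∈ s, ‖c‖ ≤ R) (h : ∀ c ∈ s, ∀ d ∈ s, c ≠ d → δ ≤ ‖c - d‖) :
    (s.card : ℝ) * (δ / 2) ^ finrank ℝ E ≤ (R + δ / 2) ^ finrank ℝ E := by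
  borelize E
  let μ : Measure E := Measure.addHaar
  have hδ2 : 0 < δ / 2 := by positivity
  have hρ : 0 < R + δ / 2 := by positivity
  have hdisj : Set.Pairwise (s : Set E) (Function.onFun Disjoint fun c => ball c (δ / 2)) := by
    intro c hc d hd hcd
    apply ball_disjoint_ball
    rw [dist_eq_norm]
    linarith [h c hc d hd hcd]
  have hsub : ⋃ c ∈ s, ball c (δ / 2) ⊆ ball (0 : E) (R + δ / 2) := by
    refine Set.iUnion₂_subset fun c hc => ball_subset_ball' ?_
    rw [dist_zero_right]
    linarith [hs c hc]
  have hvol : (s.card : ℝ≥0∞) * ENNReal.ofReal ((δ / 2) ^ finrank ℝ E) * μ (ball 0 1) ≤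
      ENNReal.ofReal ((R + δ / 2) ^ finrank ℝ E) * μ (ball 0 1) := by
    rw [← μ.addHaar_ball_of_pos 0 hρ]
    refine le_trans (le_of_eq ?_) (measure_mono hsub)
    rw [measure_biUnion_finset hdisj fun c _ => measurableSet_ball]
    simp only [μ.addHaar_ball_of_pos _ hδ2, Finset.sum_const, nsmul_eq_mul, mul_assoc]
  have hcard : (s.card : ℝ≥0∞) * ENNReal.ofReal ((δ / 2) ^ finrank ℝ E) ≤
      ENNReal.ofReal ((R + δ / 2) ^ finrank ℝ E) :=
    (ENNReal.mul_le_mul_iff_left (measure_ball_pos _ _ zero_lt_one).ne' measure_ball_lt_top.ne).1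
      hvol
  have hreal := ENNReal.toReal_le_of_le_ofReal (pow_nonneg hρ.le _) hcard
  rwa [ENNReal.toReal_mul, ENNReal.toReal_natCast, ENNReal.toReal_ofReal (by positivity)] at hreal

/-- A ball of radius `R` contains a finite `δ`-net with at most `(1 + 2R/δ)^d` points. -/
lemma exists_net_card_le {R δ : ℝ} (hR : 0 ≤ R) (hδ : 0 < δ) :
    ∃ s : Finset E, (∀ c ∈ s, ‖c‖ ≤ R) ∧ (∀ x : E, ‖x‖ ≤ R → ∃ c ∈ s, ‖x - c‖ ≤ δ) ∧
      (s.card : ℝ) ≤ (1 + 2 * R / δ) ^ finrank ℝ E := by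
  lift δ to ℝ≥0 using hδ.le
  have htop : packingNumber δ (closedBall (0 : E) R) ≠ ⊤ := by
    have hne : δ / 2 ≠ 0 := by
      have : 0 < δ := by exact_mod_cast hδ
      positivity
    obtain ⟨N, -, hN, hcov⟩ :=
      exists_finite_isCover_of_isCompact hne (isCompact_closedBall (0 : E) R)
    have hle := (packingNumber_two_mul_le_externalCoveringNumber (δ / 2) _).trans
      hcov.externalCoveringNumber_le_encard
    rw [mul_div_cancel₀ _ (two_ne_zero)] at hle
    exact ne_top_of_le_ne_top hN.encard_lt_top.ne hle
  have hsub := maximalSeparatedSet_subset (ε := δ) (A := closedBall (0 : E) R)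
  have hsep := isSeparated_maximalSeparatedSet (ε := δ) (A := closedBall (0 : E) R)
  have hfin : (maximalSeparatedSet δ (closedBall (0 : E) R)).Finite := by
    rw [← Set.encard_lt_top_iff, encard_maximalSeparatedSet htop]
    exact htop.lt_top
  have hcov := (isCover_maximalSeparatedSet htop).subset_iUnion_closedBall
  have hs : ∀ c ∈ hfin.toFinset, ‖c‖ ≤ R := fun c hc => by
    simpa using hsub (hfin.mem_toFinset.1 hc)
  refine ⟨hfin.toFinset, hs, fun x hx => ?_, ?_⟩
  · have hx' := hcov (show x ∈ closedBall (0 : E) R by simpa using hx)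
    simp only [Set.mem_iUnion, mem_closedBall, dist_eq_norm] at hx'
    obtain ⟨c, hc, hxc⟩ := hx'
    exact ⟨c, hfin.mem_toFinset.2 hc, hxc⟩
  · have hcard := card_mul_pow_le_of_separated hfin.toFinset hR hδ hs fun c hc d hd hcd => by
      have hcd' : (δ : ℝ≥0∞) < edist c d :=
        hsep (hfin.mem_toFinset.1 hc) (hfin.mem_toFinset.1 hd) hcd
      rw [edist_nndist, ENNReal.coe_lt_coe] at hcd'
      rw [← dist_eq_norm]
      exact_mod_cast hcd'.le
    rw [← le_div_iff₀ (by positivity), ← div_pow] at hcard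
    refine hcard.trans_eq ?_
    congr 1
    field_simp
    ring

/-- In positive dimension, a ball of radius `R` contains a finite `δ`-net with fewer than
`(3R/δ)^d` points, for every `δ ≤ R`. -/
lemma exists_net_card_lt (hE : finrank ℝ E ≠ 0) {R δ : ℝ} (hδ : 0 < δ) (hδR : δ ≤ R) :
    ∃ s : Finset E, (∀ c ∈ s, ‖c‖ ≤ R) ∧ (∀ x : E, ‖x‖ ≤ R → ∃ c ∈ s, ‖x - c‖ ≤ δ) ∧
      (s.card : ℝ) < (3 * R / δ) ^ finrank ℝ E := by
  have hR : 0 < R := hδ.trans_le hδR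
  rcases hδR.eq_or_lt with rfl | hlt
  · refine ⟨{0}, by simpa using hR.le, by simp, ?_⟩
    rw [mul_div_cancel_right₀ _ hR.ne', Finset.card_singleton, Nat.cast_one]
    exact one_lt_pow₀ (by norm_num) hE
  · obtain ⟨s, hs, hcov, hcard⟩ := exists_net_card_le (E := E) hR.le hδ
    refine ⟨s, hs, hcov, hcard.trans_lt (pow_lt_pow_left₀ ?_ (by positivity) hE)⟩
    have : 1 < R / δ := (one_lt_div hδ).2 hlt
    calc 1 + 2 * R / δ < R / δ + 2 * R / δ := by linarith
      _ = 3 * R / δ := by ring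

end Net

section Sampling

open ProbabilityTheory

variable {W : Type*} [MeasurableSpace W] (α : Measure W) [IsProbabilityMeasure α]

/-- One-sided Hoeffding inequality for the empirical mean of `m` independent samples. -/
lemma measureReal_le_empirical_sub_integral_le {X : W → ℝ} (hX : Measurable X) {M : ℝ}
    (hM : ∀ w, |X w| ≤ M) {m : ℕ} (hm : 0 < m) {t : ℝ} (ht : 0 ≤ t) :
    (Measure.pi fun _ : Fin m => α).real
        {w | t ≤ (1 / (m : ℝ)) * ∑ i, X (w i) - ∫ w', X w' ∂α} ≤
      Real.exp (-(m * t ^ 2 / (2 * M ^ 2))) := by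
  have hm' : (0 : ℝ) < m := by exact_mod_cast hm
  have hsub := hasSubgaussianMGF_of_mem_Icc (μ := α) (a := -M) (b := M) hX.aemeasurable
    (ae_of_all _ fun w => abs_le.1 (hM w))
  have hY : Measurable fun w => X w - ∫ w', X w' ∂α := hX.sub_const _
  have hind : iIndepFun (fun (i : Fin m) (w : Fin m → W) => X (w i) - ∫ w', X w' ∂α)
      (Measure.pi fun _ : Fin m => α) :=
    iIndepFun_pi (X := fun _ w => X w - ∫ w', X w' ∂α) fun _ => hY.aemeasurable
  have hsub' (i : Fin m) : HasSubgaussianMGF (fun w : Fin m → W => X (w i) - ∫ w', X w' ∂α)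
      ((‖M - -M‖₊ / 2) ^ 2) (Measure.pi fun _ : Fin m => α) := by
    have hmp := measurePreserving_eval (fun _ : Fin m => α) i
    refine HasSubgaussianMGF.of_map (Y := Function.eval i)
      (X := fun w => X w - ∫ w', X w' ∂α) hmp.measurable.aemeasurable ?_
    rwa [hmp.map_eq]
  have hH := HasSubgaussianMGF.measure_sum_ge_le_of_iIndepFun hind (s := Finset.univ) (fun i _ => hsub' i)
    (ε := m * t) (by positivity)
  have hset : {w : Fin m → W | t ≤ (1 / (m : ℝ)) * ∑ i, X (w i) - ∫ w', X w' ∂α} =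
      {w | m * t ≤ ∑ i, (X (w i) - ∫ w', X w' ∂α)} := by
    ext w
    simp only [Set.mem_ofPred_eq, Finset.sum_sub_distrib, Finset.sum_const, Finset.card_univ,
      Fintype.card_fin, nsmul_eq_mul]
    rw [← mul_le_mul_iff_right₀ hm', mul_sub, ← mul_assoc, mul_one_div_cancel hm'.ne', one_mul]
  rw [hset]
  refine hH.trans_eq ?_
  congr 1
  have hc : (((‖M - -M‖₊ / 2) ^ 2 : ℝ≥0) : ℝ) = M ^ 2 := by
    push_cast
    rw [div_pow, Real.norm_eq_abs, sq_abs]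
    ring
  rw [NNReal.coe_sum]
  simp only [hc, Finset.sum_const, Finset.card_univ, Fintype.card_fin, nsmul_eq_mul]
  rcases eq_or_ne M 0 with rfl | hM0
  · simp
  · field_simp

/-- Two-sided Hoeffding inequality for the empirical mean of `m` independent samples. -/
lemma measureReal_le_abs_empirical_sub_integral_le {X : W → ℝ} (hX : Measurable X) {M : ℝ}
    (hM : ∀ w, |X w| ≤ M) {m : ℕ} (hm : 0 < m) {t : ℝ} (ht : 0 ≤ t) :
    (Measure.pi fun _ : Fin m => α).real
        {w | t ≤ |(1 / (m : ℝ)) * ∑ i, X (w i) - ∫ w', X w' ∂α|} ≤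
      2 * Real.exp (-(m * t ^ 2 / (2 * M ^ 2))) := by
  have hpos := measureReal_le_empirical_sub_integral_le α hX hM hm ht
  have hneg := measureReal_le_empirical_sub_integral_le α hX.neg (M := M)
    (fun w => by simpa using hM w) hm ht
  have hsub : {w : Fin m → W | t ≤ |(1 / (m : ℝ)) * ∑ i, X (w i) - ∫ w', X w' ∂α|} ⊆
      {w | t ≤ (1 / (m : ℝ)) * ∑ i, X (w i) - ∫ w', X w' ∂α} ∪
      {w | t ≤ (1 / (m : ℝ)) * ∑ i, (-X) (w i) - ∫ w', (-X) w' ∂α} := by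
    intro w hw
    rw [Set.mem_ofPred_eq, le_abs] at hw
    rcases hw with h | h
    · exact Or.inl h
    · refine Or.inr ?_
      simp only [Set.mem_ofPred_eq, Pi.neg_apply, Finset.sum_neg_distrib, integral_neg]
      linarith
  linarith [(measureReal_mono (μ := Measure.pi fun _ : Fin m => α) hsub
    (measure_ne_top _ _)).trans (measureReal_union_le _ _)]

/-- Union bound: if `|s|` is small compared with the Hoeffding tail, then some sample of size `m`
has empirical means close to the true means simultaneously for all functions indexed by `s`. -/
lemma exists_sample_forall_abs_empirical_sub_integral_lt {ι : Type*} (s : Finset ι)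
    {X : ι → W → ℝ} (hX : ∀ j, Measurable (X j)) {M : ℝ} (hM : ∀ j ∈ s, ∀ w, |X j w| ≤ M)
    {m : ℕ} (hm : 0 < m) {t : ℝ} (ht : 0 ≤ t)
    (hs : s.card * (2 * Real.exp (-(m * t ^ 2 / (2 * M ^ 2)))) < 1) :
    ∃ w : Fin m → W, ∀ j ∈ s, |(1 / (m : ℝ)) * ∑ i, X j (w i) - ∫ w', X j w' ∂α| < t := by
  by_contra! hcon
  have huniv : (Set.univ : Set (Fin m → W)) ⊆
      ⋃ j ∈ s, {w | t ≤ |(1 / (m : ℝ)) * ∑ i, X j (w i) - ∫ w', X j w' ∂α|} := by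
    intro w _
    obtain ⟨j, hj, hw⟩ := hcon w
    exact Set.mem_biUnion hj hw
  have hle := (measureReal_mono (μ := Measure.pi fun _ : Fin m => α) huniv
    (measure_ne_top _ _)).trans
    ((measureReal_biUnion_finset_le _ _).trans (Finset.sum_le_sum fun j hj =>
      measureReal_le_abs_empirical_sub_integral_le α (hX j) (hM j hj) hm ht))
  rw [probReal_univ, Finset.sum_const, nsmul_eq_mul] at hle
  linarith

end Sampling

/-- For an `L`-Lipschitz family, moving from `c` to `x` increases the distance between the empirical
mean and the mean by at most `2L‖x - c‖`. -/
lemma abs_empirical_sub_integral_le_of_lipschitz {W E : Type*} [MeasurableSpace W]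
    [NormedAddCommGroup E] {f : W → E → ℝ} (α : Measure W) [IsProbabilityMeasure α] {L : ℝ}
    (hLip : ∀ w x y, |f w x - f w y| ≤ L * ‖x - y‖) {x c : E}
    (hx : Integrable (fun w => f w x) α) (hc : Integrable (fun w => f w c) α)
    {m : ℕ} (hm : 0 < m) (w : Fin m → W) :
    |(1 / (m : ℝ)) * ∑ i, f (w i) x - ∫ w', f w' x ∂α| ≤
      |(1 / (m : ℝ)) * ∑ i, f (w i) c - ∫ w', f w' c ∂α| + 2 * (L * ‖x - c‖) := by
  have hm' : (0 : ℝ) < m := by exact_mod_cast hm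
  have hemp : |(1 / (m : ℝ)) * ∑ i, f (w i) x - (1 / (m : ℝ)) * ∑ i, f (w i) c| ≤
      L * ‖x - c‖ := by
    rw [← mul_sub, ← Finset.sum_sub_distrib, abs_mul, abs_of_pos (by positivity)]
    calc (1 / (m : ℝ)) * |∑ i, (f (w i) x - f (w i) c)|
        ≤ (1 / (m : ℝ)) * ∑ _i : Fin m, L * ‖x - c‖ := by
          gcongr
          exact (Finset.abs_sum_le_sum_abs _ _).trans
            (Finset.sum_le_sum fun i _ => hLip _ _ _)
      _ = L * ‖x - c‖ := by
          rw [Finset.sum_const, Finset.card_univ, Fintype.card_fin, nsmul_eq_mul]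
          field_simp
  have hint : |∫ w', f w' x ∂α - ∫ w', f w' c ∂α| ≤ L * ‖x - c‖ := by
    rw [← integral_sub hx hc, ← Real.norm_eq_abs]
    simpa using norm_integral_le_of_norm_le_const (μ := α)
      (f := fun w' => f w' x - f w' c) (ae_of_all _ fun w' => hLip w' x c)
  rw [abs_le] at hemp hint
  have hcc := abs_le.1 (le_refl |(1 / (m : ℝ)) * ∑ i, f (w i) c - ∫ w', f w' c ∂α|)
  exact abs_le.2 ⟨by linarith, by linarith⟩

theorem stmt8 {W : Type*} [MeasurableSpace W] {k : ℕ}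
    (f : W → EuclideanSpace ℝ (Fin k) → ℝ)
    (hmeas : Measurable (fun p : W × EuclideanSpace ℝ (Fin k) => f p.1 p.2))
    (L M R : ℝ)
    (hLip : ∀ w x y, |f w x - f w y| ≤ L * ‖x - y‖)
    (hBdd : ∀ w, ∀ x : EuclideanSpace ℝ (Fin k), ‖x‖ ≤ R → |f w x| ≤ M)
    (α : Measure W) [IsProbabilityMeasure α]
    (ε : ℝ) (hε : 0 < ε) (hε' : ε ≤ 4 * L * R)
    (m : ℕ) (hm : 0 < m)
    (hmbig : (8 * M ^ 2 / ε ^ 2) * ((k : ℝ) * Real.log (12 * L * R / ε) + Real.log 2) ≤ m) :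
    ∃ w : Fin m → W, ∀ x : EuclideanSpace ℝ (Fin k), ‖x‖ ≤ R →
      |(1 / (m : ℝ)) * ∑ i, f (w i) x - ∫ w', f w' x ∂α| ≤ ε := by
  have hW : Nonempty W := nonempty_of_isProbabilityMeasure α
  obtain ⟨w₀⟩ := hW
  rcases lt_or_ge R 0 with hR | hR
  · exact ⟨fun _ => w₀, fun x hx => absurd ((norm_nonneg x).trans hx) hR.not_ge⟩
  have hLR : 0 < L * R := by linarith
  have hRpos : 0 < R := hR.lt_of_ne fun h => by simp [← h] at hLR
  have hL : 0 < L := pos_of_mul_pos_left hLR hR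
  have hM : 0 ≤ M := (abs_nonneg _).trans (hBdd w₀ 0 (by simpa using hR))
  have hfx (x : EuclideanSpace ℝ (Fin k)) : Measurable fun w => f w x :=
    hmeas.comp (measurable_id.prodMk measurable_const)
  have hint (x : EuclideanSpace ℝ (Fin k)) (hx : ‖x‖ ≤ R) : Integrable (fun w => f w x) α :=
    Integrable.of_bound (hfx x).aestronglyMeasurable M (ae_of_all _ fun w => hBdd w x hx)
  rcases hM.eq_or_lt with rfl | hMpos
  · have hzero (w : W) (x : EuclideanSpace ℝ (Fin k)) (hx : ‖x‖ ≤ R) : f w x = 0 :=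
      abs_nonpos_iff.1 (hBdd w x hx)
    refine ⟨fun _ => w₀, fun x hx => ?_⟩
    simp [hzero _ x hx, hε.le]
  have hexp : k * Real.log (12 * L * R / ε) + Real.log 2 ≤ m * (ε / 2) ^ 2 / (2 * M ^ 2) := by
    rw [div_mul_eq_mul_div, div_le_iff₀ (by positivity)] at hmbig
    rw [le_div_iff₀ (by positivity)]
    linarith
  have hbase : 0 < 12 * L * R / ε := div_pos (by linarith) hε
  rcases Nat.eq_zero_or_pos k with rfl | hk
  · have hlog : Real.log 2 < m * ε ^ 2 / (2 * M ^ 2) := by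
      have h2 : 0 < Real.log 2 := Real.log_pos one_lt_two
      have h4 : m * ε ^ 2 / (2 * M ^ 2) = 4 * (m * (ε / 2) ^ 2 / (2 * M ^ 2)) := by ring
      simp only [Nat.cast_zero, zero_mul, zero_add] at hexp
      linarith
    obtain ⟨w, hw⟩ := exists_sample_forall_abs_empirical_sub_integral_lt α {0} hfx
      (M := M) (fun j hj w => hBdd w j (by simpa [Finset.mem_singleton.1 hj] using hR)) hm hε.le
      (by
        have hlt := Real.exp_lt_exp.2 (neg_lt_neg hlog)
        rw [Real.exp_neg (Real.log 2), Real.exp_log two_pos] at hlt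
        rw [Finset.card_singleton, Nat.cast_one]
        linarith)
    refine ⟨w, fun x _ => ?_⟩
    rw [Subsingleton.elim x 0]
    exact (hw 0 (Finset.mem_singleton_self 0)).le
  · have hδ : 0 < ε / (4 * L) := by positivity
    have hδR : ε / (4 * L) ≤ R := by
      rw [div_le_iff₀ (by positivity)]
      linarith
    obtain ⟨s, hs, hcov, hcard⟩ := exists_net_card_lt (E := EuclideanSpace ℝ (Fin k))
      (by simpa using hk.ne') hδ hδR
    have hcard' : (s.card : ℝ) < (12 * L * R / ε) ^ k := by
      rw [finrank_euclideanSpace_fin] at hcard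
      refine hcard.trans_eq ?_
      congr 1
      field_simp
      ring
    have htail : Real.exp (-(m * (ε / 2) ^ 2 / (2 * M ^ 2))) ≤
        ((12 * L * R / ε) ^ k)⁻¹ * 2⁻¹ := by
      refine (Real.exp_le_exp.2 (neg_le_neg hexp)).trans_eq ?_
      rw [neg_add, Real.exp_add, Real.exp_neg, Real.exp_neg, Real.exp_log two_pos,
        Real.exp_nat_mul, Real.exp_log hbase]
    obtain ⟨w, hw⟩ := exists_sample_forall_abs_empirical_sub_integral_lt α s hfx
      (M := M) (fun j hj w => hBdd w j (hs j hj)) hm (half_pos hε).le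
      (by
        have hp : 0 < (12 * L * R / ε) ^ k := pow_pos hbase k
        calc (s.card : ℝ) * (2 * Real.exp (-(m * (ε / 2) ^ 2 / (2 * M ^ 2))))
            ≤ s.card * (2 * (((12 * L * R / ε) ^ k)⁻¹ * 2⁻¹)) := by gcongr
          _ = s.card / (12 * L * R / ε) ^ k := by ring
          _ < 1 := (div_lt_one hp).2 hcard')
    refine ⟨w, fun x hx => ?_⟩
    obtain ⟨c, hc, hxc⟩ := hcov x hx
    have happrox := abs_empirical_sub_integral_le_of_lipschitz α hLip (hint x hx)
      (hint c (hs c hc)) hm w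
    have hdist : L * ‖x - c‖ ≤ ε / 4 := by
      calc L * ‖x - c‖ ≤ L * (ε / (4 * L)) := by gcongr
        _ = ε / 4 := by field_simp
    linarith [hw c hc]
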